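/- arXiv:2501.04233 — 9 statements merged into one kernel-verified Lean document; each statement's English description precedes it below -/
import Mathlib

section
/- Let p be an odd prime and n a positive integer with p^n ≡ 3 (mod 4), and let χ be the quadratic character of the finite field F_{p^n}. Then the sum over all x in F_{p^n} of χ(x·(x − 1/2)·(x − 1)) equals 0. -/
theorem stmt_0 (p n : ℕ) (hp : p.Prime) (hodd : p ≠ 2) (hn : 0 < n)
    (h3 : p ^ n % 4 = 3)
    (F : Type*) [Field F] [Fintype F] [DecidableEq F]
    (hcard : Fintype.card F = p ^ n) :
    ∑ x : F, quadraticChar F (x * (x - 1/2) * (x - 1)) = 0 := by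
  have h2 : (2 : F) ≠ 0 := by
    refine Ring.two_ne_zero fun h => ?_
    have := FiniteField.even_card_of_char_two h
    omega
  have hneg : quadraticChar F (-1) = -1 := by
    rw [quadraticChar_neg_one_iff_not_isSquare, FiniteField.isSquare_neg_one_iff, hcard]
    exact not_not.mpr h3
  have hsymm : ∑ x : F, quadraticChar F (x * (x - 1/2) * (x - 1)) =
      -∑ x : F, quadraticChar F (x * (x - 1/2) * (x - 1)) := by
    rw [← Finset.sum_neg_distrib, ← Equiv.sum_comp (Equiv.subLeft (1 : F))]
    refine Finset.sum_congr rfl fun x _ => ?_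
    have hx : (1 - x) * (1 - x - 1/2) * (1 - x - 1) = -1 * (x * (x - 1/2) * (x - 1)) := by
      field_simp
      ring
    rw [Equiv.subLeft_apply, hx, map_mul, hneg, neg_one_mul]
  omega
end

section
/- Let p be an odd prime and n a positive integer with p^n ≡ 3 (mod 4), and let χ be the quadratic character of the finite field F_{p^n}. Then the sum over all x in F_{p^n} of χ((x − 1/2)·(x² − x + 1/2)) equals 0. -/
theorem quadraticChar_neg_of_card_mod_four {F : Type*} [Field F] [Fintype F] [DecidableEq F]
    (h : Fintype.card F % 4 = 3) (a : F) : quadraticChar F (-a) = -quadraticChar F a := by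
  have h1 : quadraticChar F (-1) = -1 := by
    rw [quadraticChar_neg_one_iff_not_isSquare, FiniteField.isSquare_neg_one_iff]
    simpa using h
  rw [← neg_one_mul, map_mul, h1, neg_one_mul]

theorem stmt_1 (p n : ℕ) (hp : p.Prime) (hodd : p ≠ 2) (hn : 0 < n)
    (h3 : p ^ n % 4 = 3)
    (F : Type*) [Field F] [Fintype F] [DecidableEq F]
    (hcard : Fintype.card F = p ^ n) :
    ∑ x : F, quadraticChar F ((x - 1/2) * (x^2 - x + 1/2)) = 0 := by
  rw [← hcard] at h3
  have h2 : (2 : F) ≠ 0 := Ring.two_ne_zero fun h => by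
    have := FiniteField.even_card_of_char_two h
    omega
  have hneg : ∑ x : F, quadraticChar F ((x - 1/2) * (x^2 - x + 1/2)) =
      -∑ x : F, quadraticChar F ((x - 1/2) * (x^2 - x + 1/2)) := by
    rw [← Finset.sum_neg_distrib]
    refine Fintype.sum_equiv (Equiv.subLeft 1) _ _ fun x => ?_
    rw [← quadraticChar_neg_of_card_mod_four h3, Equiv.subLeft_apply]
    congr 1
    field_simp
    ring
  omega
end

section
/- Let p be an odd prime and n a positive integer with p^n ≡ 3 (mod 4), and let χ be the quadratic character of the finite field F_{p^n}. Then the sum over all x in F_{p^n} of χ(x·(x − 1)·(x² − x + 1/2)) equals −1. -/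
section QuadraticCharSums

variable {F : Type*} [Field F] [Fintype F] [DecidableEq F]

/-- Summing over squares amounts to weighting each element by its number of square roots. -/
theorem sum_comp_sq_eq_sum_quadraticChar (hF : ringChar F ≠ 2) (g : F → ℤ) :
    ∑ y : F, g (y ^ 2) = ∑ a : F, (1 + quadraticChar F a) * g a := by
  rw [← Finset.sum_fiberwise Finset.univ (fun y : F => y ^ 2)]
  refine Finset.sum_congr rfl fun a _ => ?_
  rw [Finset.sum_congr rfl (g := fun _ => g a)
    (fun y hy => by rw [(Finset.mem_filter.mp hy).2]), Finset.sum_const, nsmul_eq_mul,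
    add_comm, ← quadraticChar_card_sqrts hF a]
  congr 3
  ext y
  simp

theorem sum_quadraticChar_mul_sub_one (hF : ringChar F ≠ 2) :
    ∑ b : F, quadraticChar F b * quadraticChar F (b - 1) = -1 := by
  have hJ := jacobiSum_nontrivial_inv (quadraticChar_ne_one hF)
  rw [(quadraticChar_isQuadratic F).inv, jacobiSum] at hJ
  have hsq : quadraticChar F (-1) * quadraticChar F (-1) = 1 := by
    rw [← map_mul]; simp
  have h : ∀ b : F, quadraticChar F b * quadraticChar F (b - 1) =
      quadraticChar F (-1) * (quadraticChar F b * quadraticChar F (1 - b)) := fun b => by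
    rw [mul_left_comm, ← map_mul (quadraticChar F) (-1), neg_one_mul, neg_sub]
  rw [Finset.sum_congr rfl fun b _ => h b, ← Finset.mul_sum, hJ, mul_neg, hsq]

theorem sum_quadraticChar_sq_sub_one (hF : ringChar F ≠ 2) :
    ∑ a : F, quadraticChar F (a ^ 2 - 1) = -1 := by
  rw [sum_comp_sq_eq_sum_quadraticChar hF (fun a => quadraticChar F (a - 1))]
  simp only [add_mul, one_mul, Finset.sum_add_distrib]
  have hshift : ∑ a : F, quadraticChar F (a - 1) = 0 :=
    (Fintype.sum_equiv (Equiv.subRight 1) _ _ fun _ => rfl).trans (quadraticChar_sum_zero hF)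
  rw [sum_quadraticChar_mul_sub_one hF, hshift, zero_add]

theorem sum_quadraticChar_pow_four_sub_one (hF : ringChar F ≠ 2)
    (hneg : quadraticChar F (-1) = -1) :
    ∑ y : F, quadraticChar F (y ^ 4 - 1) = -1 := by
  have hodd : ∑ a : F, quadraticChar F a * quadraticChar F (a ^ 2 - 1) = 0 := by
    have h := Equiv.sum_comp (Equiv.neg F)
      (fun a : F => quadraticChar F a * quadraticChar F (a ^ 2 - 1))
    have hn (a : F) : quadraticChar F (-a) = -quadraticChar F a := by
      rw [← neg_one_mul a, map_mul, hneg, neg_one_mul]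
    simp only [Equiv.neg_apply, hn, neg_sq, neg_mul, Finset.sum_neg_distrib] at h
    linarith
  have h := sum_comp_sq_eq_sum_quadraticChar hF (fun a => quadraticChar F (a ^ 2 - 1))
  simp only [add_mul, one_mul, Finset.sum_add_distrib, ← pow_mul] at h
  rw [hodd, sum_quadraticChar_sq_sub_one hF, add_zero] at h
  exact h

end QuadraticCharSums

theorem stmt_2 (p n : ℕ) (hp : p.Prime) (hodd : p ≠ 2) (hn : 0 < n)
    (h3 : p ^ n % 4 = 3)
    (F : Type*) [Field F] [Fintype F] [DecidableEq F]
    (hcard : Fintype.card F = p ^ n) :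
    ∑ x : F, quadraticChar F (x * (x - 1) * (x^2 - x + 1/2)) = -1 := by
  have hF : ringChar F ≠ 2 := fun h => by
    have := FiniteField.even_card_of_char_two h
    omega
  have hneg : quadraticChar F (-1) = -1 := by
    rw [quadraticChar_neg_one_iff_not_isSquare, FiniteField.isSquare_neg_one_iff]
    omega
  have h2 : (2 : F) ≠ 0 := Ring.two_ne_zero hF
  rw [← sum_quadraticChar_pow_four_sub_one hF hneg,
    ← ((Equiv.mulLeft₀ (2 : F) h2).trans (Equiv.subRight 1)).sum_comp
      (fun y => quadraticChar F (y ^ 4 - 1))]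
  refine Finset.sum_congr rfl fun x _ => ?_
  have hx : (2 * x - 1) ^ 4 - 1 = (2 ^ 2) ^ 2 * (x * (x - 1) * (x ^ 2 - x + 1 / 2)) := by
    field_simp
    ring
  simp only [Equiv.trans_apply, Equiv.mulLeft₀_apply, Equiv.subRight_apply]
  rw [hx, map_mul _ ((2 ^ 2) ^ 2), quadraticChar_sq_one' (pow_ne_zero 2 h2), one_mul]
end

section
/- Let p be an odd prime and n a positive integer with p^n ≡ 3 (mod 4), and let χ be the quadratic character of the finite field F_{p^n}. Then the sum over all x in F_{p^n} of χ((x − 1)·(x² − x + 1/2)) equals λ_{p,n}, where λ_{p,n} denotes the sum over all x in F_{p^n} of χ(x·(x² − 2x − 1)). -/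
theorem card_roots_monic_quadratic {F : Type*} [Field F] [Fintype F] [DecidableEq F]
    (hF : ringChar F ≠ 2) (c b : F) :
    ((Finset.univ.filter fun x : F => x ^ 2 + c * x + b = 0).card : ℤ) =
      quadraticChar F (c ^ 2 - 4 * b) + 1 := by
  have h2 : (2 : F) ≠ 0 := Ring.two_ne_zero hF
  rw [← quadraticChar_card_sqrts hF]
  congr 1
  refine Finset.card_bij (fun x _ => 2 * x + c) ?_ ?_ ?_
  · intro x hx
    simp only [Finset.mem_filter, Finset.mem_univ, true_and] at hx
    simp only [Set.mem_toFinset, Set.mem_ofPred_eq]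
    linear_combination 4 * hx
  · intro x _ y _ h
    exact mul_left_cancel₀ h2 (add_right_cancel h)
  · intro y hy
    simp only [Set.mem_toFinset, Set.mem_ofPred_eq] at hy
    refine ⟨(y - c) / 2, ?_, by field_simp; ring⟩
    simp only [Finset.mem_filter, Finset.mem_univ, true_and]
    field_simp
    linear_combination hy

/-- The curves `y² = x(x² + ax + b)` and `y² = x(x² - 2ax + a² - 4b)`, which are related by a
2-isogeny, have the same quadratic character sum. -/
theorem sum_quadraticChar_two_isogeny {F : Type*} [Field F] [Fintype F] [DecidableEq F]
    (hF : ringChar F ≠ 2) (a b : F) (hb : b ≠ 0) :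
    ∑ x : F, quadraticChar F (x * (x ^ 2 + a * x + b)) =
      ∑ u : F, quadraticChar F (u * (u ^ 2 - 2 * a * u + (a ^ 2 - 4 * b))) := by
  have inner_sum (x : F) :
      ∑ u : F, (if x ^ 2 + (a - u) * x + b = 0 then quadraticChar F u else 0) =
        quadraticChar F (x * (x ^ 2 + a * x + b)) := by
    rcases eq_or_ne x 0 with rfl | hx
    · simp [hb]
    · have key (u : F) : x ^ 2 + (a - u) * x + b = 0 ↔ (x ^ 2 + a * x + b) / x = u := by
        rw [div_eq_iff hx]
        constructor <;> intro h <;> linear_combination h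
      simp only [key, Finset.sum_ite_eq, Finset.mem_univ, if_true]
      have hmul : x * (x ^ 2 + a * x + b) = x ^ 2 * ((x ^ 2 + a * x + b) / x) := by
        field_simp
      rw [hmul, map_mul, quadraticChar_sq_one' hx, one_mul]
  simp_rw [← inner_sum]
  rw [Finset.sum_comm]
  have outer_sum (u : F) :
      ∑ x : F, (if x ^ 2 + (a - u) * x + b = 0 then quadraticChar F u else 0) =
        quadraticChar F (u * (u ^ 2 - 2 * a * u + (a ^ 2 - 4 * b))) + quadraticChar F u := by
    rw [← Finset.sum_filter, Finset.sum_const, nsmul_eq_mul,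
      card_roots_monic_quadratic hF, map_mul,
      show (a - u) ^ 2 - 4 * b = u ^ 2 - 2 * a * u + (a ^ 2 - 4 * b) by ring]
    ring
  simp_rw [outer_sum]
  rw [Finset.sum_add_distrib, quadraticChar_sum_zero hF, add_zero]

theorem stmt_3 (p n : ℕ) (hp : p.Prime) (hodd : p ≠ 2) (hn : 0 < n)
    (h3 : p ^ n % 4 = 3)
    (F : Type*) [Field F] [Fintype F] [DecidableEq F]
    (hcard : Fintype.card F = p ^ n) :
    ∑ x : F, quadraticChar F ((x - 1) * (x^2 - x + 1/2)) =
      ∑ x : F, quadraticChar F (x * (x^2 - 2*x - 1)) := by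
  have hF : ringChar F ≠ 2 := by
    intro h
    have := FiniteField.even_card_of_char_two h
    omega
  have h2 : (2 : F) ≠ 0 := Ring.two_ne_zero hF
  rw [← Equiv.sum_comp (Equiv.addRight (1 : F))]
  convert sum_quadraticChar_two_isogeny hF 1 (1 / 2) (one_div_ne_zero h2) using 3 with x _ x _
  · simp only [Equiv.coe_addRight]
    ring
  · field_simp
    ring
end

section
/- Let p be an odd prime and n a positive integer with p^n ≡ 3 (mod 4), and let χ be the quadratic character of F_{p^n}. Then the number of triples (y₁,y₂,y₃) ∈ (F_{p^n}\{0})³ with χ(y₁) = χ(y₂) = χ(y₃) = 1 satisfying y₁ − y₂ + y₃ − 1 = 0 and y₁² − y₂² + y₃² − 1 = 0 equals p^n − 2. -/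
/-- Exactly half of the nonzero elements of a finite field of odd characteristic are squares. -/
theorem two_mul_card_quadraticChar_eq_one (F : Type*) [Field F] [Fintype F] [DecidableEq F]
    (hF : ringChar F ≠ 2) :
    2 * ((Finset.univ.filter fun a : F => quadraticChar F a = 1).card : ℤ) =
      Fintype.card F - 1 := by
  have hpt : ∀ a : F, 2 * (if quadraticChar F a = 1 then (1 : ℤ) else 0) =
      quadraticChar F a + (1 - if a = 0 then 1 else 0) := by
    intro a
    by_cases ha : a = 0
    · simp [ha]
    · rcases quadraticChar_dichotomy ha with h | h <;> simp [h, ha]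
  have hsum := Finset.sum_congr (rfl : (Finset.univ : Finset F) = Finset.univ) fun a _ => hpt a
  rw [← Finset.mul_sum, Finset.sum_add_distrib, quadraticChar_sum_zero hF,
    Finset.sum_sub_distrib] at hsum
  simpa using hsum

theorem stmt_8 (p n : ℕ) (hp : p.Prime) (hodd : p ≠ 2) (hn : 0 < n)
    (h3 : p ^ n % 4 = 3)
    (F : Type*) [Field F] [Fintype F] [DecidableEq F]
    (hcard : Fintype.card F = p ^ n) :
    (Set.ncard {y : F × F × F |
        y.1 ≠ 0 ∧ y.2.1 ≠ 0 ∧ y.2.2 ≠ 0 ∧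
        quadraticChar F y.1 = 1 ∧ quadraticChar F y.2.1 = 1 ∧
        quadraticChar F y.2.2 = 1 ∧
        y.1 - y.2.1 + y.2.2 - 1 = 0 ∧
        y.1 ^ 2 - y.2.1 ^ 2 + y.2.2 ^ 2 - 1 = 0} : ℤ) = p ^ n - 2 := by
  have hF : ringChar F ≠ 2 := by
    intro h
    have := FiniteField.even_card_of_char_two h
    omega
  have h2 : (2 : F) ≠ 0 := Ring.two_ne_zero hF
  set S : Finset F := Finset.univ.filter fun a => quadraticChar F a = 1 with hS
  have hset : {y : F × F × F |
        y.1 ≠ 0 ∧ y.2.1 ≠ 0 ∧ y.2.2 ≠ 0 ∧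
        quadraticChar F y.1 = 1 ∧ quadraticChar F y.2.1 = 1 ∧
        quadraticChar F y.2.2 = 1 ∧
        y.1 - y.2.1 + y.2.2 - 1 = 0 ∧
        y.1 ^ 2 - y.2.1 ^ 2 + y.2.2 ^ 2 - 1 = 0} =
      ((S.image (fun a => ((1 : F), a, a)) ∪ S.image (fun a => (a, a, (1 : F))) :
        Finset (F × F × F)) : Set (F × F × F)) := by
    have hne : ∀ a : F, quadraticChar F a = 1 → a ≠ 0 := by
      rintro a ha rfl
      simp at ha
    ext ⟨x, y, z⟩
    simp only [Set.mem_ofPred_eq, Finset.coe_union, Finset.coe_image, Set.mem_union, Set.mem_image,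
      Finset.mem_coe, hS, Finset.mem_filter, Finset.mem_univ, true_and, Prod.mk.injEq]
    constructor
    · rintro ⟨-, -, -, hx, -, hz, e₁, e₂⟩
      have hy : y = x + z - 1 := by linear_combination -e₁
      subst hy
      have hprod : 2 * ((x - 1) * (z - 1)) = 0 := by linear_combination -e₂
      rcases mul_eq_zero.1 ((mul_eq_zero.1 hprod).resolve_left h2) with h | h
      · have hx1 : x = 1 := by linear_combination h
        exact Or.inl ⟨z, hz, hx1.symm, by rw [hx1]; ring, rfl⟩
      · have hz1 : z = 1 := by linear_combination h
        exact Or.inr ⟨x, hx, rfl, by rw [hz1]; ring, hz1.symm⟩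
    · rintro (⟨a, ha, rfl, rfl, rfl⟩ | ⟨a, ha, rfl, rfl, rfl⟩)
      · exact ⟨one_ne_zero, hne a ha, hne a ha, map_one _, ha, ha, by ring, by ring⟩
      · exact ⟨hne a ha, hne a ha, one_ne_zero, ha, ha, map_one _, by ring, by ring⟩
  have hinter : S.image (fun a => ((1 : F), a, a)) ∩ S.image (fun a => (a, a, (1 : F))) =
      {(1, 1, 1)} := by
    ext ⟨x, y, z⟩
    simp only [Finset.mem_inter, Finset.mem_image, hS, Finset.mem_filter, Finset.mem_univ,
      true_and, Prod.mk.injEq, Finset.mem_singleton]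
    constructor
    · rintro ⟨⟨a, -, rfl, rfl, rfl⟩, b, -, rfl, rfl, -⟩
      exact ⟨rfl, rfl, rfl⟩
    · rintro ⟨rfl, rfl, rfl⟩
      exact ⟨⟨1, map_one _, rfl, rfl, rfl⟩, 1, map_one _, rfl, rfl, rfl⟩
  have hcount := Finset.card_union_add_card_inter (S.image (fun a => ((1 : F), a, a)))
    (S.image (fun a => (a, a, (1 : F))))
  rw [hinter, Finset.card_singleton,
    Finset.card_image_of_injective S (f := fun a => ((1 : F), a, a))
      (fun a b h => (Prod.mk.inj (Prod.mk.inj h).2).1),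
    Finset.card_image_of_injective S (f := fun a => (a, a, (1 : F)))
      (fun a b h => (Prod.mk.inj h).1)] at hcount
  have hhalf := two_mul_card_quadraticChar_eq_one F hF
  rw [← hS, hcard] at hhalf
  push_cast at hhalf
  rw [hset, Set.ncard_coe_finset]
  omega
end

section
/- Let p be an odd prime and n a positive integer with p^n ≡ 3 (mod 4), and let χ be the quadratic character of F_{p^n}. Then the number of quadruples (y₁,y₂,y₃,y₄) ∈ (F_{p^n}\{0})⁴ with χ(y₁) = χ(y₂) = χ(y₃) = χ(y₄) = −1 satisfying y₁ − y₂ + y₃ − y₄ = 0 equals (1/16)·(p^n − 1)·(p^{2n} − 2p^n + 5). -/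
section NonsquareDifferences

variable {F : Type*} [Field F] [Fintype F] [DecidableEq F]

/-- The indicator function of the nonsquares of a finite field. -/
def nonsquareInd (x : F) : ℚ := if quadraticChar F x = -1 then 1 else 0

/-- The number of representations of `t` as a difference of two nonsquares. -/
def nonsquareDiff (t : F) : ℚ := ∑ b : F, nonsquareInd b * nonsquareInd (b + t)

lemma nonsquareInd_mul_of_quadraticChar_eq_one {s : F} (hs : quadraticChar F s = 1) (x : F) :
    nonsquareInd (s * x) = nonsquareInd x := by
  simp only [nonsquareInd, map_mul, hs, one_mul]

lemma nonsquareDiff_neg (t : F) : nonsquareDiff (-t) = nonsquareDiff t := by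
  unfold nonsquareDiff
  rw [← Equiv.sum_comp (Equiv.addRight t)]
  refine Finset.sum_congr rfl fun b _ => ?_
  simp [mul_comm]

lemma nonsquareDiff_eq_of_quadraticChar_eq_one {s : F} (hs : quadraticChar F s = 1) :
    nonsquareDiff s = nonsquareDiff (1 : F) := by
  have hs0 : s ≠ 0 := by
    rintro rfl
    simp at hs
  unfold nonsquareDiff
  rw [← Equiv.sum_comp (Equiv.mulLeft₀ s hs0)]
  refine Finset.sum_congr rfl fun b _ => ?_
  have h : s * b + s = s * (b + 1) := by ring
  simp only [Equiv.mulLeft₀_apply, h, nonsquareInd_mul_of_quadraticChar_eq_one hs]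

lemma nonsquareDiff_zero : nonsquareDiff (0 : F) = ∑ x : F, nonsquareInd x := by
  simp only [nonsquareDiff, nonsquareInd, add_zero, mul_ite, mul_one, mul_zero, ← ite_and,
    and_self]

lemma sum_nonsquareDiff :
    ∑ t : F, nonsquareDiff t = (∑ x : F, nonsquareInd x) ^ 2 := by
  unfold nonsquareDiff
  rw [Finset.sum_comm, sq, Finset.sum_mul]
  refine Finset.sum_congr rfl fun b _ => ?_
  rw [← Finset.mul_sum]
  congr 1
  exact Equiv.sum_comp (Equiv.addLeft b) nonsquareInd

lemma quadraticChar_neg_of_card_mod_four_s10 (hF : Fintype.card F % 4 = 3) (x : F) :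
    quadraticChar F (-x) = -quadraticChar F x := by
  have h : quadraticChar F (-1) = -1 := by
    rw [quadraticChar_neg_one_iff_not_isSquare, FiniteField.isSquare_neg_one_iff]
    simpa using hF
  rw [neg_eq_neg_one_mul, map_mul, h, neg_one_mul]

lemma nonsquareDiff_eq_of_ne_zero (hF : Fintype.card F % 4 = 3) {t : F} (ht : t ≠ 0) :
    nonsquareDiff t = nonsquareDiff (1 : F) := by
  rcases quadraticChar_dichotomy ht with h | h
  · exact nonsquareDiff_eq_of_quadraticChar_eq_one h
  · rw [← nonsquareDiff_neg]
    apply nonsquareDiff_eq_of_quadraticChar_eq_one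
    rw [quadraticChar_neg_of_card_mod_four_s10 hF, h, neg_neg]

lemma sum_nonsquareInd (hF : Fintype.card F % 4 = 3) :
    ∑ x : F, nonsquareInd x = ((Fintype.card F : ℚ) - 1) / 2 := by
  have hneg : ∑ x : F, nonsquareInd (-x) = ∑ x : F, nonsquareInd x :=
    Equiv.sum_comp (Equiv.neg F) nonsquareInd
  have hadd : ∑ x : F, (nonsquareInd x + nonsquareInd (-x)) =
      ∑ x : F, (1 - if x = 0 then (1 : ℚ) else 0) := by
    refine Finset.sum_congr rfl fun x _ => ?_
    simp only [nonsquareInd, quadraticChar_neg_of_card_mod_four_s10 hF]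
    rcases eq_or_ne x 0 with rfl | hx
    · simp
    · rcases quadraticChar_dichotomy hx with h | h <;> norm_num [h, hx]
  rw [Finset.sum_add_distrib, hneg, Finset.sum_sub_distrib] at hadd
  simp only [Finset.sum_const, Finset.card_univ, nsmul_eq_mul, mul_one, Finset.sum_ite_eq',
    Finset.mem_univ, if_true] at hadd
  linarith

lemma sum_comp_nonsquareDiff (hF : Fintype.card F % 4 = 3) (g : ℚ → ℚ) :
    ∑ t : F, g (nonsquareDiff t) =
      g (nonsquareDiff (0 : F)) + ((Fintype.card F : ℚ) - 1) * g (nonsquareDiff (1 : F)) := by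
  rw [← Finset.add_sum_erase _ _ (Finset.mem_univ (0 : F))]
  congr 1
  rw [Finset.sum_congr rfl fun t ht =>
    congrArg g (nonsquareDiff_eq_of_ne_zero hF (Finset.ne_of_mem_erase ht))]
  rw [Finset.sum_const, Finset.card_erase_of_mem (Finset.mem_univ _), Finset.card_univ,
    nsmul_eq_mul, Nat.cast_pred Fintype.card_pos]

lemma nonsquareDiff_one (hF : Fintype.card F % 4 = 3) :
    nonsquareDiff (1 : F) = ((Fintype.card F : ℚ) - 3) / 4 := by
  have h := sum_comp_nonsquareDiff hF id
  simp only [id] at h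
  rw [sum_nonsquareDiff, nonsquareDiff_zero, sum_nonsquareInd hF] at h
  have hq : (Fintype.card F : ℚ) - 1 ≠ 0 := by
    have : (1 : ℚ) < Fintype.card F := by exact_mod_cast Fintype.one_lt_card (α := F)
    linarith
  apply mul_left_cancel₀ hq
  linarith

lemma sum_nonsquareDiff_sq (hF : Fintype.card F % 4 = 3) :
    ∑ t : F, nonsquareDiff t ^ 2 =
      1 / 16 * ((Fintype.card F : ℚ) - 1) *
        ((Fintype.card F : ℚ) ^ 2 - 2 * (Fintype.card F : ℚ) + 5) := by
  rw [sum_comp_nonsquareDiff hF (· ^ 2), nonsquareDiff_zero, sum_nonsquareInd hF,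
    nonsquareDiff_one hF]
  ring

lemma ncard_nonsquare_quadruples :
    (Set.ncard {y : F × F × F × F |
        y.1 ≠ 0 ∧ y.2.1 ≠ 0 ∧ y.2.2.1 ≠ 0 ∧ y.2.2.2 ≠ 0 ∧
        quadraticChar F y.1 = -1 ∧ quadraticChar F y.2.1 = -1 ∧
        quadraticChar F y.2.2.1 = -1 ∧ quadraticChar F y.2.2.2 = -1 ∧
        y.1 - y.2.1 + y.2.2.1 - y.2.2.2 = 0} : ℚ) = ∑ t : F, nonsquareDiff t ^ 2 := by
  let e : F × F × F → F × F × F × F := fun z => (z.2.1 + z.1, z.2.1, z.2.2, z.2.2 + z.1)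
  have he : Function.Injective e := by
    rintro ⟨t, b, c⟩ ⟨t', b', c'⟩ h
    simp only [e, Prod.mk.injEq] at h
    obtain ⟨h1, rfl, rfl, -⟩ := h
    simpa using h1
  have hne {x : F} (hx : quadraticChar F x = -1) : x ≠ 0 := by
    rintro rfl
    simp at hx
  have himage : {y : F × F × F × F |
        y.1 ≠ 0 ∧ y.2.1 ≠ 0 ∧ y.2.2.1 ≠ 0 ∧ y.2.2.2 ≠ 0 ∧
        quadraticChar F y.1 = -1 ∧ quadraticChar F y.2.1 = -1 ∧
        quadraticChar F y.2.2.1 = -1 ∧ quadraticChar F y.2.2.2 = -1 ∧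
        y.1 - y.2.1 + y.2.2.1 - y.2.2.2 = 0} =
      e '' ↑(Finset.univ.filter fun z : F × F × F =>
        (quadraticChar F z.2.1 = -1 ∧ quadraticChar F (z.2.1 + z.1) = -1) ∧
        (quadraticChar F z.2.2 = -1 ∧ quadraticChar F (z.2.2 + z.1) = -1)) := by
    ext ⟨a, b, c, d⟩
    simp only [Set.mem_ofPred_eq, Set.mem_image, Finset.coe_filter, Finset.mem_univ, true_and]
    constructor
    · rintro ⟨-, -, -, -, ha, hb, hc, hd, h⟩
      have h1 : b + (a - b) = a := by ring
      have h2 : c + (a - b) = d := by linear_combination h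
      exact ⟨(a - b, b, c), by simp only [h1, h2]; exact ⟨⟨hb, ha⟩, hc, hd⟩,
        by simp only [e, h1, h2]⟩
    · rintro ⟨⟨t, b', c'⟩, ⟨⟨hb, ha⟩, hc, hd⟩, h⟩
      simp only [e, Prod.mk.injEq] at h
      obtain ⟨rfl, rfl, rfl, rfl⟩ := h
      exact ⟨hne ha, hne hb, hne hc, hne hd, ha, hb, hc, hd, by ring⟩
  rw [himage, Set.ncard_image_of_injective _ he, Set.ncard_coe_finset, Finset.card_filter]
  push_cast
  rw [Fintype.sum_prod_type]
  refine Finset.sum_congr rfl fun t _ => ?_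
  rw [Fintype.sum_prod_type, sq, nonsquareDiff, Finset.sum_mul_sum]
  refine Finset.sum_congr rfl fun b _ => Finset.sum_congr rfl fun c _ => ?_
  simp only [nonsquareInd, ← ite_and, mul_ite, mul_one, mul_zero]
  split_ifs <;> simp_all

end NonsquareDifferences


theorem stmt_10 (p n : ℕ) (hp : p.Prime) (hodd : p ≠ 2) (hn : 0 < n)
    (h3 : p ^ n % 4 = 3)
    (F : Type*) [Field F] [Fintype F] [DecidableEq F]
    (hcard : Fintype.card F = p ^ n) :
    (Set.ncard {y : F × F × F × F |
        y.1 ≠ 0 ∧ y.2.1 ≠ 0 ∧ y.2.2.1 ≠ 0 ∧ y.2.2.2 ≠ 0 ∧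
        quadraticChar F y.1 = -1 ∧ quadraticChar F y.2.1 = -1 ∧
        quadraticChar F y.2.2.1 = -1 ∧ quadraticChar F y.2.2.2 = -1 ∧
        y.1 - y.2.1 + y.2.2.1 - y.2.2.2 = 0} : ℚ) =
      1/16 * ((p : ℚ) ^ n - 1) * ((p : ℚ) ^ (2 * n) - 2 * (p : ℚ) ^ n + 5) := by
  rw [ncard_nonsquare_quadruples, sum_nonsquareDiff_sq (hcard ▸ h3), hcard]
  push_cast
  ring
end

section
/- Let p be an odd prime and n a positive integer with p^n ≡ 3 (mod 4), and let f₁ : F_{p^n} → F_{p^n} be given by f₁(x) = x^{(p^n+3)/2} + x². Then the differential uniformity of f₁, i.e., the maximum of δ_{f₁}(a,b) over all a ∈ F_{p^n}\{0} and b ∈ F_{p^n}, equals (p^n + 1)/4. -/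
section QuadraticCharacter

variable {F : Type*} [Field F] [Fintype F] [DecidableEq F]

theorem quadraticChar_neg_of_card_mod_four_eq_three (h3 : Fintype.card F % 4 = 3) (x : F) :
    quadraticChar F (-x) = -quadraticChar F x := by
  have h2 : ringChar F ≠ 2 := fun h ↦ by
    have := FiniteField.even_card_of_char_two h
    omega
  have h1 : quadraticChar F (-1) = -1 := by
    rw [quadraticChar_neg_one_iff_not_isSquare, FiniteField.isSquare_neg_one_iff]
    omega
  rw [neg_eq_neg_one_mul, map_mul, h1, neg_one_mul]

theorem sum_quadraticChar_mul_quadraticChar_add (hF : ringChar F ≠ 2) {a : F} (ha : a ≠ 0) :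
    ∑ x : F, quadraticChar F x * quadraticChar F (x + a) = -1 := by
  have hJ := jacobiSum_nontrivial_inv (quadraticChar_ne_one hF)
  rw [(quadraticChar_isQuadratic F).inv, jacobiSum] at hJ
  have hs : ∑ x : F, quadraticChar F x * quadraticChar F (x + a) =
      ∑ y : F, quadraticChar F (-a * y) * quadraticChar F (-a * y + a) :=
    (Equiv.sum_comp (Equiv.mulLeft₀ (-a) (neg_ne_zero.mpr ha))
      fun x ↦ quadraticChar F x * quadraticChar F (x + a)).symm
  have hy : ∀ y : F, quadraticChar F (-a * y) * quadraticChar F (-a * y + a) =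
      quadraticChar F (-1) * (quadraticChar F y * quadraticChar F (1 - y)) := fun y ↦ by
    have hsq := quadraticChar_sq_one' ha
    rw [← map_mul, ← map_mul, ← map_mul, ← one_mul (quadraticChar F (-1 * _)), ← hsq, ← map_mul]
    congr 1
    ring
  rw [hs, Finset.sum_congr rfl fun y _ ↦ hy y, ← Finset.mul_sum, hJ]
  have := quadraticChar_sq_one (F := F) (neg_ne_zero.mpr one_ne_zero)
  linarith

theorem four_mul_card_quadraticChar_ne_one (h3 : Fintype.card F % 4 = 3) {a : F} (ha : a ≠ 0) :
    4 * (Finset.univ.filter fun x : F ↦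
      quadraticChar F x ≠ 1 ∧ quadraticChar F (x + a) ≠ 1).card = Fintype.card F + 1 := by
  have h2 : ringChar F ≠ 2 := fun h ↦ by
    have := FiniteField.even_card_of_char_two h
    omega
  have hind : ∀ x : F, 1 - quadraticChar F x + (if x = 0 then 1 else 0) =
      if quadraticChar F x ≠ 1 then 2 else 0 := fun x ↦ by
    by_cases hx : x = 0
    · simp [hx]
    · rcases quadraticChar_dichotomy hx with h | h <;> simp [hx, h]
  have hprod : ∀ x : F, (if quadraticChar F x ≠ 1 ∧ quadraticChar F (x + a) ≠ 1
      then (4 : ℤ) else 0) = 1 - quadraticChar F x - quadraticChar F (x + a) +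
        quadraticChar F x * quadraticChar F (x + a) +
        (if x = 0 then 1 - quadraticChar F a else 0) +
        (if x = -a then 1 + quadraticChar F a else 0) := fun x ↦ by
    have e : (if quadraticChar F x ≠ 1 ∧ quadraticChar F (x + a) ≠ 1 then (4 : ℤ) else 0) =
        (if quadraticChar F x ≠ 1 then 2 else 0) *
          (if quadraticChar F (x + a) ≠ 1 then 2 else 0) := by
      split_ifs <;> simp_all
    rw [e, ← hind, ← hind]
    simp only [add_eq_zero_iff_eq_neg]
    by_cases hx : x = 0
    · subst hx
      simp [ha, eq_comm]
      ring
    · by_cases hxa : x = -a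
      · subst hxa
        simp [ha, quadraticChar_neg_of_card_mod_four_eq_three h3]
        ring
      · simp only [hx, hxa, if_false]
        ring
  have hshift : ∑ x : F, quadraticChar F (x + a) = 0 :=
    (Equiv.sum_comp (Equiv.addRight a) (quadraticChar F)).trans (quadraticChar_sum_zero h2)
  zify
  calc (4 : ℤ) * (Finset.univ.filter fun x : F ↦
        quadraticChar F x ≠ 1 ∧ quadraticChar F (x + a) ≠ 1).card
      = ∑ x : F, if quadraticChar F x ≠ 1 ∧ quadraticChar F (x + a) ≠ 1
          then (4 : ℤ) else 0 := by
        rw [← Finset.sum_filter, Finset.sum_const, nsmul_eq_mul, mul_comm]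
    _ = Fintype.card F + 1 := by
        rw [Finset.sum_congr rfl fun x _ ↦ hprod x]
        simp only [Finset.sum_add_distrib, Finset.sum_sub_distrib, hshift,
          quadraticChar_sum_zero h2, sum_quadraticChar_mul_quadraticChar_add h2 ha,
          Finset.sum_ite_eq', Finset.mem_univ, if_true, Finset.sum_const, Finset.card_univ,
          nsmul_eq_mul]
        ring

theorem eq_of_sq_eq_sq_of_quadraticChar_eq_one (h3 : Fintype.card F % 4 = 3) {u v : F}
    (hu : quadraticChar F u = 1) (hv : quadraticChar F v = 1) (h : u ^ 2 = v ^ 2) : u = v := by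
  rcases sq_eq_sq_iff_eq_or_eq_neg.mp h with h | h
  · exact h
  · rw [h, quadraticChar_neg_of_card_mod_four_eq_three h3, hv] at hu
    norm_num at hu

theorem sq_ne_neg_sq_of_quadraticChar_eq_one (h3 : Fintype.card F % 4 = 3) {u v : F}
    (hu : quadraticChar F u = 1) (hv : quadraticChar F v = 1) : u ^ 2 ≠ -v ^ 2 := fun h ↦ by
  have := congrArg (quadraticChar F) h
  rw [quadraticChar_neg_of_card_mod_four_eq_three h3, map_pow, map_pow, hu, hv] at this
  norm_num at this

theorem pow_card_add_three_div_two_add_sq (h3 : Fintype.card F % 4 = 3) (x : F) :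
    x ^ ((Fintype.card F + 3) / 2) + x ^ 2 = if quadraticChar F x = 1 then 2 * x ^ 2 else 0 := by
  have h2 : ringChar F ≠ 2 := fun h ↦ by
    have := FiniteField.even_card_of_char_two h
    omega
  rw [show (Fintype.card F + 3) / 2 = Fintype.card F / 2 + 2 by omega, pow_add,
    ← quadraticChar_eq_pow_of_char_ne_two' h2]
  by_cases hx : x = 0
  · simp [hx]
  · rcases quadraticChar_dichotomy hx with h | h
    · simp [h, two_mul]
    · simp [h]

end QuadraticCharacter

theorem stmt_11 (p n : ℕ) (hp : p.Prime) (hodd : p ≠ 2) (hn : 0 < n)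
    (h3 : p ^ n % 4 = 3)
    (F : Type*) [Field F] [Fintype F] [DecidableEq F]
    (hcard : Fintype.card F = p ^ n)
    (f₁ : F → F) (hf₁ : ∀ x, f₁ x = x ^ ((p ^ n + 3) / 2) + x ^ 2) :
    IsGreatest {k : ℕ | ∃ a b : F, a ≠ 0 ∧
        Set.ncard {x : F | f₁ (x + a) - f₁ x = b} = k}
      ((p ^ n + 1) / 4) := by
  rw [← hcard] at h3 hf₁ ⊢
  have h2 : ringChar F ≠ 2 := fun h ↦ by
    have := FiniteField.even_card_of_char_two h
    omega
  have two_ne : (2 : F) ≠ 0 := Ring.two_ne_zero h2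
  have hf : ∀ x, f₁ x = if quadraticChar F x = 1 then 2 * x ^ 2 else 0 := fun x ↦
    (hf₁ x).trans (pow_card_add_three_div_two_add_sq h3 x)
  have hne : ∀ {x : F}, quadraticChar F x = 1 → x ≠ 0 := by
    rintro x hx rfl
    simp at hx
  have hzero : ∀ a : F, a ≠ 0 →
      Set.ncard {x : F | f₁ (x + a) - f₁ x = 0} = (Fintype.card F + 1) / 4 := by
    intro a ha
    have hset : {x : F | f₁ (x + a) - f₁ x = 0} = ↑(Finset.univ.filter fun x : F ↦
        quadraticChar F x ≠ 1 ∧ quadraticChar F (x + a) ≠ 1) := by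
      ext x
      simp only [Set.mem_ofPred_eq, Finset.coe_filter, Finset.mem_univ, true_and, hf]
      by_cases hx : quadraticChar F x = 1 <;> by_cases hxa : quadraticChar F (x + a) = 1
      · simp only [hx, hxa, if_true, ne_eq, not_true, false_and, iff_false]
        intro h
        have h' : (x + a) ^ 2 = x ^ 2 := mul_left_cancel₀ two_ne (sub_eq_zero.mp h)
        exact ha (by simpa using eq_of_sq_eq_sq_of_quadraticChar_eq_one h3 hxa hx h')
      · simp [-quadraticChar_apply, hx, hxa, two_ne, hne hx]
      · simp [-quadraticChar_apply, hx, hxa, two_ne, hne hxa]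
      · simp [-quadraticChar_apply, hx, hxa]
    have := four_mul_card_quadraticChar_ne_one h3 ha
    rw [hset, Set.ncard_coe_finset]
    omega
  refine ⟨⟨1, 0, one_ne_zero, hzero 1 one_ne_zero⟩, ?_⟩
  rintro k ⟨a, b, ha, rfl⟩
  by_cases hb : b = 0
  · rw [hb, hzero a ha]
  set P : Set F := {x : F | f₁ (x + a) - f₁ x = b} with hP
  let A : Set F := {x ∈ P | quadraticChar F x = 1 ∧ quadraticChar F (x + a) = 1}
  let B : Set F := {x ∈ P | ¬ (quadraticChar F x = 1 ∧ quadraticChar F (x + a) = 1)}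
  have hPAB : P = A ∪ B := by
    ext x
    simp only [A, B, Set.mem_union, Set.mem_ofPred_eq]
    tauto
  have hA : A.Subsingleton := by
    rintro x ⟨hx, hx1, hx2⟩ y ⟨hy, hy1, hy2⟩
    simp only [hP, Set.mem_ofPred_eq, hf, hx1, hx2, hy1, hy2, if_true] at hx hy
    have h : (2 * 2 * a) * x = (2 * 2 * a) * y := by linear_combination hx - hy
    exact mul_left_cancel₀ (by simp [two_ne, ha]) h
  have hBcases : ∀ x ∈ B, (quadraticChar F (x + a) = 1 ∧ 2 * (x + a) ^ 2 = b) ∨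
      (quadraticChar F x = 1 ∧ -(2 * x ^ 2) = b) := by
    rintro x ⟨hx, hx'⟩
    simp only [hP, Set.mem_ofPred_eq, hf] at hx
    by_cases hx1 : quadraticChar F x = 1 <;> by_cases hx2 : quadraticChar F (x + a) = 1
    · exact absurd ⟨hx1, hx2⟩ hx'
    · exact Or.inr ⟨hx1, by simpa [-quadraticChar_apply, hx1, hx2] using hx⟩
    · exact Or.inl ⟨hx2, by simpa [-quadraticChar_apply, hx1, hx2] using hx⟩
    · exact absurd (by simpa [-quadraticChar_apply, hx1, hx2] using hx.symm) hb
  have hB : B.Subsingleton := by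
    intro x hx y hy
    rcases hBcases x hx with ⟨hx, ex⟩ | ⟨hx, ex⟩ <;> rcases hBcases y hy with ⟨hy, ey⟩ | ⟨hy, ey⟩
    · exact add_right_cancel (eq_of_sq_eq_sq_of_quadraticChar_eq_one h3 hx hy
        (mul_left_cancel₀ two_ne (ex.trans ey.symm)))
    · exact absurd (mul_left_cancel₀ two_ne (by linear_combination ex - ey))
        (sq_ne_neg_sq_of_quadraticChar_eq_one h3 hx hy)
    · exact absurd (mul_left_cancel₀ two_ne (by linear_combination ey - ex))
        (sq_ne_neg_sq_of_quadraticChar_eq_one h3 hy hx)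
    · exact eq_of_sq_eq_sq_of_quadraticChar_eq_one h3 hx hy
        (mul_left_cancel₀ two_ne (by linear_combination ey - ex))
  have hA1 : A.ncard ≤ 1 := Set.ncard_le_one_iff_subsingleton.mpr hA
  have hB1 : B.ncard ≤ 1 := Set.ncard_le_one_iff_subsingleton.mpr hB
  have hle : P.ncard ≤ A.ncard + B.ncard := hPAB ▸ Set.ncard_union_le A B
  rcases A.eq_empty_or_nonempty with hA0 | ⟨x, -, hx1, hx2⟩
  · rw [hA0, Set.ncard_empty] at hle
    omega
  · have hcard3 : Fintype.card F ≠ 3 := fun h ↦ ha <| by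
      have e1 := quadraticChar_eq_pow_of_char_ne_two' h2 x
      have e2 := quadraticChar_eq_pow_of_char_ne_two' h2 (x + a)
      rw [hx1, h] at e1
      rw [hx2, h] at e2
      norm_num at e1 e2
      linear_combination e1 - e2
    omega
end

section
/- Let p be an odd prime and n a positive integer with p^n ≡ 3 (mod 4), and let f₁ : F_{p^n} → F_{p^n} be given by f₁(x) = x^{(p^n+3)/2} + x². Then for every pair (a,b) with a ∈ F_{p^n}\{0} and b ∈ F_{p^n}\{0}, the DDT entry δ_{f₁}(a,b) is at most 2. -/
theorem not_isSquare_neg_one_of_card {F : Type*} [Field F] [Fintype F]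
    (h : Fintype.card F % 4 = 3) : ¬ IsSquare (-1 : F) := fun hs =>
  FiniteField.isSquare_neg_one_iff.mp hs h

theorem eq_of_isSquare_of_sq_eq_sq {F : Type*} [Field F] (h : ¬ IsSquare (-1 : F))
    {u v : F} (hu : IsSquare u) (hv : IsSquare v) (huv : u ^ 2 = v ^ 2) : u = v := by
  rcases sq_eq_sq_iff_eq_or_eq_neg.mp huv with h' | h'
  · exact h'
  · by_cases hv0 : v = 0
    · simp [h', hv0]
    · refine absurd ?_ h
      have : (-1 : F) = u / v := by rw [h']; field_simp
      rw [this]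
      exact hu.div hv

theorem eq_zero_of_sq_eq_neg_sq {F : Type*} [Field F] (h : ¬ IsSquare (-1 : F))
    {u v : F} (huv : u ^ 2 = -v ^ 2) : v = 0 := by
  by_contra hv
  refine h ⟨u / v, ?_⟩
  field_simp
  exact huv.symm

theorem isSquare_and_pow_add_sq_eq_or {F : Type*} [Field F] [Fintype F] (h2 : ringChar F ≠ 2)
    (h3 : Fintype.card F % 4 = 3) (x : F) :
    (IsSquare x ∧ x ^ ((Fintype.card F + 3) / 2) + x ^ 2 = 2 * x ^ 2) ∨
      (¬ IsSquare x ∧ x ^ ((Fintype.card F + 3) / 2) + x ^ 2 = 0) := by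
  have he : (Fintype.card F + 3) / 2 = Fintype.card F / 2 + 2 := by omega
  rw [he, pow_add]
  by_cases hx : x = 0
  · left; simp [hx]
  · by_cases hs : IsSquare x
    · left
      refine ⟨hs, ?_⟩
      rw [(FiniteField.isSquare_iff h2 hx).mp hs]; ring
    · right
      refine ⟨hs, ?_⟩
      rcases FiniteField.pow_dichotomy h2 hx with h | h
      · exact absurd ((FiniteField.isSquare_iff h2 hx).mpr h) hs
      · rw [h]; ring

theorem stmt_12 (p n : ℕ) (hp : p.Prime) (hodd : p ≠ 2) (hn : 0 < n)
    (h3 : p ^ n % 4 = 3)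
    (F : Type*) [Field F] [Fintype F] [DecidableEq F]
    (hcard : Fintype.card F = p ^ n)
    (f₁ : F → F) (hf₁ : ∀ x, f₁ x = x ^ ((p ^ n + 3) / 2) + x ^ 2) :
    ∀ a b : F, a ≠ 0 → b ≠ 0 →
      Set.ncard {x : F | f₁ (x + a) - f₁ x = b} ≤ 2 := by
  intro a b ha hb
  rw [← hcard] at h3 hf₁
  have hchar : ringChar F ≠ 2 := fun h => by
    have := FiniteField.even_card_of_char_two h
    omega
  have h2 : (2 : F) ≠ 0 := Ring.two_ne_zero hchar
  have hneg := not_isSquare_neg_one_of_card h3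
  have hf : ∀ x, (IsSquare x ∧ f₁ x = 2 * x ^ 2) ∨ (¬ IsSquare x ∧ f₁ x = 0) := fun x => by
    rw [hf₁]; exact isSquare_and_pow_add_sq_eq_or hchar h3 x
  set A : Set F := {x | f₁ (x + a) - f₁ x = b ∧ IsSquare x ∧ IsSquare (x + a)} with hA
  set B : Set F := {x | f₁ (x + a) - f₁ x = b ∧ ¬ (IsSquare x ∧ IsSquare (x + a))} with hB
  have hAB : {x : F | f₁ (x + a) - f₁ x = b} = A ∪ B := by
    ext x
    simp only [hA, hB, Set.mem_union, Set.mem_ofPred_eq]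
    tauto
  have hA1 : A.ncard ≤ 1 := by
    refine (Set.ncard_le_one (Set.toFinite A)).mpr ?_
    rintro x ⟨hx, hx1, hx2⟩ y ⟨hy, hy1, hy2⟩
    have ex := (hf x).resolve_right fun h => h.1 hx1
    have ex' := (hf (x + a)).resolve_right fun h => h.1 hx2
    have ey := (hf y).resolve_right fun h => h.1 hy1
    have ey' := (hf (y + a)).resolve_right fun h => h.1 hy2
    rw [ex.2, ex'.2] at hx
    rw [ey.2, ey'.2] at hy
    refine mul_left_cancel₀ (mul_ne_zero (mul_ne_zero h2 h2) ha) ?_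
    linear_combination hx - hy
  have hBcases : ∀ x ∈ B, (IsSquare (x + a) ∧ 2 * (x + a) ^ 2 = b) ∨
      (IsSquare x ∧ 2 * x ^ 2 = -b) := by
    rintro x ⟨hx, hns⟩
    rcases hf x with ⟨h, e⟩ | ⟨h, e⟩ <;> rcases hf (x + a) with ⟨h', e'⟩ | ⟨h', e'⟩ <;>
      rw [e, e'] at hx
    · exact absurd ⟨h, h'⟩ hns
    · exact Or.inr ⟨h, by linear_combination -hx⟩
    · exact Or.inl ⟨h', by linear_combination hx⟩
    · exact absurd (by simpa using hx.symm) hb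
  have hcontra : ∀ u v : F, 2 * u ^ 2 = b → 2 * v ^ 2 = -b → False := fun u v hu hv => by
    have := eq_zero_of_sq_eq_neg_sq hneg (u := u) (v := v)
      (mul_left_cancel₀ h2 (by linear_combination hu + hv))
    apply hb
    rw [this] at hv
    linear_combination hv
  have hB1 : B.ncard ≤ 1 := by
    refine (Set.ncard_le_one (Set.toFinite B)).mpr ?_
    intro x hx y hy
    rcases hBcases x hx with ⟨sx, ex⟩ | ⟨sx, ex⟩ <;>
      rcases hBcases y hy with ⟨sy, ey⟩ | ⟨sy, ey⟩
    · exact add_right_cancel (eq_of_isSquare_of_sq_eq_sq hneg sx sy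
        (mul_left_cancel₀ h2 (ex.trans ey.symm)))
    · exact (hcontra _ _ ex ey).elim
    · exact (hcontra _ _ ey ex).elim
    · exact eq_of_isSquare_of_sq_eq_sq hneg sx sy (mul_left_cancel₀ h2 (ex.trans ey.symm))
  rw [hAB]
  exact (Set.ncard_union_le A B).trans (by omega)
end

section
/- Let p be an odd prime and n a positive integer with p^n ≡ 3 (mod 4), and let χ be the quadratic character of F_{p^n}. Then the number N₄ of quadruples (x₁,x₂,x₃,x₄) ∈ (F_{p^n})⁴ satisfying x₁ − x₂ + x₃ − x₄ = 0 and (1+χ(x₁))x₁² − (1+χ(x₂))x₂² + (1+χ(x₃))x₃² − (1+χ(x₄))x₄² = 0 equals (1/16)·(p^n − 1)·(p^{2n} + 34p^n + 17 + 4(χ(2) − 1)·λ_{p,n}) + 1, where λ_{p,n} denotes the sum over all x in F_{p^n} of χ(x·(x² − 2x − 1)). -/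
open Finset

section QuadraticCharSums

variable {F : Type*} [Field F] [Fintype F] [DecidableEq F]

theorem two_ne_zero_of_quadraticChar_neg_one (hm : quadraticChar F (-1) = -1) : (2 : F) ≠ 0 := by
  intro h
  have h1 : (-1 : F) = 1 := by linear_combination -h
  rw [h1, map_one] at hm
  norm_num at hm

theorem ringChar_ne_two_of_quadraticChar_neg_one (hm : quadraticChar F (-1) = -1) :
    ringChar F ≠ 2 := by
  intro h
  have := ringChar.Nat.cast_ringChar (R := F)
  rw [h] at this
  exact two_ne_zero_of_quadraticChar_neg_one hm (by exact_mod_cast this)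

theorem quadraticChar_neg (hm : quadraticChar F (-1) = -1) (x : F) :
    quadraticChar F (-x) = -quadraticChar F x := by
  rw [neg_eq_neg_one_mul, map_mul, hm]
  ring

theorem add_sq_ne_zero_of_ne_zero (hm : quadraticChar F (-1) = -1) {x y : F} (hy : y ≠ 0) :
    x ^ 2 + y ^ 2 ≠ 0 := by
  intro h
  refine quadraticChar_neg_one_iff_not_isSquare.1 hm ⟨x / y, ?_⟩
  field_simp
  linear_combination -h

theorem quadraticChar_mul_sq (a : F) {b : F} (hb : b ≠ 0) :
    quadraticChar F (a * b ^ 2) = quadraticChar F a := by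
  rw [map_mul, quadraticChar_sq_one' hb, mul_one]

theorem quadraticChar_mul_self {a : F} (ha : a ≠ 0) :
    quadraticChar F a * quadraticChar F a = 1 := by
  rw [← sq, quadraticChar_sq_one ha]

theorem sum_quadraticChar_mul_quadraticChar_add_s14 (hm : quadraticChar F (-1) = -1) {u : F}
    (hu : u ≠ 0) : ∑ b, quadraticChar F b * quadraticChar F (b + u) = -1 := by
  have hF := ringChar_ne_two_of_quadraticChar_neg_one hm
  have key := jacobiSum_nontrivial_inv (quadraticChar_ne_one hF)
  rw [(quadraticChar_isQuadratic F).inv, hm, jacobiSum] at key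
  have : ∑ b, quadraticChar F b * quadraticChar F (b + u) =
      ∑ b, -(quadraticChar F b * quadraticChar F (1 - b)) := by
    refine (Fintype.sum_equiv (Equiv.mulLeft₀ (-u) (neg_ne_zero.2 hu)) _ _ fun b => ?_).symm
    change _ = quadraticChar F (-u * b) * quadraticChar F (-u * b + u)
    rw [show -u * b + u = u * (1 - b) by ring, map_mul, map_mul, quadraticChar_neg hm]
    linear_combination
      (quadraticChar F b * quadraticChar F (1 - b)) * quadraticChar_mul_self hu
  rw [this, sum_neg_distrib, key]
  ring

end QuadraticCharSums

section UnitCircle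

variable (F : Type*) [Field F] [Fintype F] [DecidableEq F]

/-- The points of the conic `x² + y² = 1` over a finite field. -/
def unitCircle : Finset (F × F) := univ.filter fun z => z.1 ^ 2 + z.2 ^ 2 = 1

variable {F}

theorem mem_unitCircle {z : F × F} : z ∈ unitCircle F ↔ z.1 ^ 2 + z.2 ^ 2 = 1 := by
  simp [unitCircle]

theorem sum_unitCircle_add (hm : quadraticChar F (-1) = -1) (g : F → ℤ) :
    ∑ z ∈ unitCircle F, g (z.1 + z.2) = ∑ s, g s * (1 + quadraticChar F (2 - s ^ 2)) := by
  have h2 := two_ne_zero_of_quadraticChar_neg_one hm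
  have h : ∑ z ∈ unitCircle F, g (z.1 + z.2) =
      ∑ w ∈ univ.filter (fun w : F × F => w.2 ^ 2 = 2 - w.1 ^ 2), g w.1 := by
    refine sum_nbij' (fun z => (z.1 + z.2, z.1 - z.2))
      (fun w => ((w.1 + w.2) / 2, (w.1 - w.2) / 2)) ?_ ?_ ?_ ?_ ?_
    · intro z hz
      rw [mem_unitCircle] at hz
      simp only [mem_filter, mem_univ, true_and]
      linear_combination 2 * hz
    · intro w hw
      simp only [mem_filter, mem_univ, true_and] at hw
      rw [mem_unitCircle]
      field_simp
      linear_combination 2 * hw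
    · intro z _
      ext <;> field_simp <;> ring
    · intro w _
      ext <;> field_simp <;> ring
    · intro z _
      rfl
  rw [h, sum_filter, Fintype.sum_prod_type]
  refine sum_congr rfl fun s _ => ?_
  rw [add_comm (1 : ℤ),
    ← quadraticChar_card_sqrts (ringChar_ne_two_of_quadraticChar_neg_one hm)]
  dsimp only
  rw [← sum_filter, sum_const, nsmul_eq_mul, mul_comm]
  congr 3
  ext
  simp

theorem sum_unitCircle_param (hm : quadraticChar F (-1) = -1) (h : F → F → ℤ) :
    ∑ z ∈ unitCircle F, h z.1 z.2 =
      h 1 0 + ∑ t, h ((t ^ 2 - 1) / (t ^ 2 + 1)) (2 * t / (t ^ 2 + 1)) := by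
  have h2 := two_ne_zero_of_quadraticChar_neg_one hm
  have ht (t : F) : t ^ 2 + 1 ≠ 0 := by
    simpa using add_sq_ne_zero_of_ne_zero hm (x := t) one_ne_zero
  have h10 : ((1 : F), (0 : F)) ∈ unitCircle F := by simp [mem_unitCircle]
  rw [← add_sum_erase _ _ h10]
  congr 1
  have hx {z : F × F} (hz : z ∈ (unitCircle F).erase (1, 0)) : 1 - z.1 ≠ 0 := by
    rw [mem_erase, mem_unitCircle] at hz
    intro h1
    have h1' : z.1 = 1 := by linear_combination -h1
    refine hz.1 (Prod.ext h1' ?_)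
    have := hz.2
    rw [h1'] at this
    simpa using this
  refine sum_nbij' (fun z => z.2 / (1 - z.1))
    (fun t => ((t ^ 2 - 1) / (t ^ 2 + 1), 2 * t / (t ^ 2 + 1))) ?_ ?_ ?_ ?_ ?_
  · intro z _
    exact mem_univ _
  · intro t _
    have := ht t
    rw [mem_erase, mem_unitCircle]
    refine ⟨fun h => ?_, ?_⟩
    · have h1 := congrArg Prod.fst h
      simp only at h1
      rw [div_eq_one_iff_eq this] at h1
      exact h2 (by linear_combination -h1)
    · field_simp
      ring
  · intro z hz
    have h1 := hx hz
    have h3 := mem_unitCircle.1 (mem_of_mem_erase hz)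
    have h4 := ht (z.2 / (1 - z.1))
    have h5 : (z.2 / (1 - z.1)) ^ 2 + 1 = 2 / (1 - z.1) := by
      field_simp
      linear_combination h3
    have h6 : (z.2 / (1 - z.1)) ^ 2 - 1 = 2 * z.1 / (1 - z.1) := by
      field_simp
      linear_combination h3
    simp only [h5, h6]
    ext <;> field_simp
  · intro t _
    have := ht t
    have h3 : 1 - (t ^ 2 - 1) / (t ^ 2 + 1) = 2 / (t ^ 2 + 1) := by
      field_simp
      ring
    simp only [h3]
    field_simp
  · intro z hz
    have h1 := hx hz
    have h3 := mem_unitCircle.1 (mem_of_mem_erase hz)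
    have h5 : (z.2 / (1 - z.1)) ^ 2 + 1 = 2 / (1 - z.1) := by
      field_simp
      linear_combination h3
    have h6 : (z.2 / (1 - z.1)) ^ 2 - 1 = 2 * z.1 / (1 - z.1) := by
      field_simp
      linear_combination h3
    simp only [h5, h6]
    congr 1 <;> field_simp

theorem card_unitCircle (hm : quadraticChar F (-1) = -1) :
    ((unitCircle F).card : ℤ) = Fintype.card F + 1 := by
  have := sum_unitCircle_param hm fun _ _ => 1
  simp only [sum_const, nsmul_eq_mul, mul_one, card_univ] at this
  rw [this, add_comm]

theorem sum_unitCircle_swap (h : F → F → ℤ) :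
    ∑ z ∈ unitCircle F, h z.1 z.2 = ∑ z ∈ unitCircle F, h z.2 z.1 := by
  refine sum_nbij' Prod.swap Prod.swap ?_ ?_ ?_ ?_ ?_ <;>
    simp [mem_unitCircle, add_comm]

theorem sum_unitCircle_neg_fst (h : F → F → ℤ) :
    ∑ z ∈ unitCircle F, h z.1 z.2 = ∑ z ∈ unitCircle F, h (-z.1) z.2 := by
  refine sum_nbij' (fun z => (-z.1, z.2)) (fun z => (-z.1, z.2)) ?_ ?_ ?_ ?_ ?_ <;>
    simp [mem_unitCircle]

theorem sum_unitCircle_quadraticChar_fst_mul (hm : quadraticChar F (-1) = -1) (h : F → ℤ) :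
    ∑ z ∈ unitCircle F, quadraticChar F z.1 * h z.2 = 0 := by
  have := sum_unitCircle_neg_fst (F := F) fun x y => quadraticChar F x * h y
  simp only [quadraticChar_neg hm, neg_mul, sum_neg_distrib] at this
  linarith

theorem sum_quadraticChar_one_add (hm : quadraticChar F (-1) = -1) :
    ∑ t : F, quadraticChar F (1 + t) = 0 := by
  rw [← quadraticChar_sum_zero (ringChar_ne_two_of_quadraticChar_neg_one hm)]
  exact Fintype.sum_equiv (Equiv.addLeft 1) _ _ fun t => rfl

theorem sum_quadraticChar_one_sub (hm : quadraticChar F (-1) = -1) :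
    ∑ t : F, quadraticChar F (1 - t) = 0 := by
  rw [← quadraticChar_sum_zero (ringChar_ne_two_of_quadraticChar_neg_one hm)]
  exact Fintype.sum_equiv (Equiv.subLeft 1) _ _ fun t => rfl

theorem sum_unitCircle_quadraticChar_one_sub (hm : quadraticChar F (-1) = -1) :
    ∑ z ∈ unitCircle F, quadraticChar F (1 - z.1 - z.2) =
      -∑ x : F, quadraticChar F (x * (x ^ 2 - 2 * x - 1)) := by
  have := sum_unitCircle_add hm fun s => quadraticChar F (1 - s)
  simp only [← sub_sub] at this
  rw [this]
  simp only [mul_add, mul_one, sum_add_distrib, sum_quadraticChar_one_sub hm, zero_add]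
  rw [← sum_neg_distrib]
  refine Fintype.sum_equiv (Equiv.subLeft 1) _ _ fun s => ?_
  rw [← quadraticChar_neg hm, ← map_mul]
  simp only [Equiv.subLeft_apply]
  congr 1
  ring

theorem sum_unitCircle_quadraticChar_one_add (hm : quadraticChar F (-1) = -1) :
    ∑ z ∈ unitCircle F, quadraticChar F (1 + z.1 + z.2) =
      -∑ x : F, quadraticChar F (x * (x ^ 2 - 2 * x - 1)) := by
  rw [← sum_unitCircle_quadraticChar_one_sub hm]
  refine sum_nbij' (fun z => (-z.1, -z.2)) (fun z => (-z.1, -z.2)) ?_ ?_ ?_ ?_ ?_ <;>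
    simp [mem_unitCircle]

theorem sum_unitCircle_quadraticChar_fst_mul_one_sub (hm : quadraticChar F (-1) = -1) :
    ∑ z ∈ unitCircle F, quadraticChar F z.1 * quadraticChar F (1 - z.1 - z.2) = 1 := by
  have h2 := two_ne_zero_of_quadraticChar_neg_one hm
  rw [sum_unitCircle_param hm fun x y => quadraticChar F x * quadraticChar F (1 - x - y)]
  have (t : F) : quadraticChar F ((t ^ 2 - 1) / (t ^ 2 + 1)) *
      quadraticChar F (1 - (t ^ 2 - 1) / (t ^ 2 + 1) - 2 * t / (t ^ 2 + 1)) =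
      -quadraticChar F 2 * quadraticChar F (1 + t) + if t = 1 then 1 else 0 := by
    have ht : t ^ 2 + 1 ≠ 0 := by
      simpa using add_sq_ne_zero_of_ne_zero hm (x := t) one_ne_zero
    split_ifs with h
    · subst h
      rw [one_add_one_eq_two]
      rw [neg_mul, quadraticChar_mul_self h2]
      simp
    · rw [← map_mul, neg_mul, ← map_mul, ← quadraticChar_neg hm, add_zero,
        ← quadraticChar_mul_sq (-(2 * (1 + t)))
          (b := (t - 1) / (t ^ 2 + 1)) (div_ne_zero (sub_ne_zero.2 h) ht)]
      congr 1
      field_simp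
      ring
  simp only [this, sum_add_distrib, ← mul_sum, sum_quadraticChar_one_add hm]
  simp

theorem sum_unitCircle_quadraticChar_mul_mul_one_sub (hm : quadraticChar F (-1) = -1) :
    ∑ z ∈ unitCircle F,
        quadraticChar F z.1 * quadraticChar F z.2 * quadraticChar F (1 - z.1 - z.2) =
      quadraticChar F 2 * ∑ x : F, quadraticChar F (x * (x ^ 2 - 2 * x - 1)) + 2 := by
  have h2 := two_ne_zero_of_quadraticChar_neg_one hm
  have h (z : F × F) (hz : z ∈ unitCircle F) :
      quadraticChar F z.1 * quadraticChar F z.2 * quadraticChar F (1 - z.1 - z.2) =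
        -quadraticChar F 2 * quadraticChar F (1 + z.1 + z.2) +
          if z.1 + z.2 = 1 then 1 else 0 := by
    rw [mem_unitCircle] at hz
    rw [← map_mul, ← map_mul]
    split_ifs with hs
    · rw [show 1 - z.1 - z.2 = 0 by linear_combination -hs,
        show 1 + z.1 + z.2 = 2 by linear_combination hs, mul_zero, neg_mul,
        quadraticChar_mul_self h2]
      simp
    · have h3 : 1 - z.1 - z.2 ≠ 0 := fun h => hs (by linear_combination -h)
      rw [neg_mul, ← map_mul, ← quadraticChar_neg hm, add_zero,
        ← quadraticChar_mul_sq (-(2 * (1 + z.1 + z.2)))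
          (b := (1 - z.1 - z.2) / 2) (div_ne_zero h3 h2)]
      congr 1
      field_simp
      linear_combination -hz
  have h1 := sum_unitCircle_add hm fun s => if s = 1 then 1 else 0
  rw [sum_congr rfl h, sum_add_distrib, ← mul_sum, sum_unitCircle_quadraticChar_one_add hm, h1]
  simp only [ite_mul, one_mul, zero_mul, sum_ite_eq', mem_univ, if_true]
  rw [show (2 : F) - 1 ^ 2 = 1 by ring, map_one]
  ring

theorem sum_unitCircle_indicator (hm : quadraticChar F (-1) = -1) :
    8 * ∑ z ∈ unitCircle F, (if quadraticChar F z.1 = 1 ∧ quadraticChar F z.2 = 1 ∧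
        quadraticChar F (z.1 + z.2 - 1) ≠ 1 then (1 : ℤ) else 0) =
      Fintype.card F + 1 + (quadraticChar F 2 - 1) *
        ∑ x : F, quadraticChar F (x * (x ^ 2 - 2 * x - 1)) := by
  have hpt (z : F × F) (hz : z ∈ unitCircle F) :
      (1 + quadraticChar F z.1) * (1 + quadraticChar F z.2) *
          (1 + quadraticChar F (1 - z.1 - z.2)) =
        8 * (if quadraticChar F z.1 = 1 ∧ quadraticChar F z.2 = 1 ∧
          quadraticChar F (z.1 + z.2 - 1) ≠ 1 then (1 : ℤ) else 0) +
        2 * (if z = (1, 0) then 1 else 0) + 2 * (if z = (0, 1) then 1 else 0) := by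
    obtain ⟨x, y⟩ := z
    rw [mem_unitCircle] at hz
    simp only [Prod.mk.injEq] at hz ⊢
    rw [show x + y - 1 = -(1 - x - y) by ring, quadraticChar_neg hm]
    by_cases hx : x = 0
    · subst hx
      have : y = 1 ∨ y = -1 := _root_.sq_eq_one_iff.1 (by simpa using hz)
      rcases this with rfl | rfl
      · simp
      · simp [hm, show (-1 : F) ≠ 1 by intro h; simp [h] at hm]
    by_cases hy : y = 0
    · subst hy
      have : x = 1 ∨ x = -1 := _root_.sq_eq_one_iff.1 (by simpa using hz)
      rcases this with rfl | rfl
      · simp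
      · simp [hm, show (-1 : F) ≠ 1 by intro h; simp [h] at hm]
    have hs : 1 - x - y ≠ 0 := by
      intro h
      have : 2 * (x * y) = 0 := by
        linear_combination (-(1 + x + y)) * h - hz
      simp [hx, hy, two_ne_zero_of_quadraticChar_neg_one hm] at this
    rcases quadraticChar_dichotomy hx with h1 | h1 <;>
      rcases quadraticChar_dichotomy hy with h2 | h2 <;>
      rcases quadraticChar_dichotomy hs with h3 | h3 <;> simp [h1, h2, h3, hx, hy]
  have h := sum_congr rfl hpt
  have h10 : ((1 : F), (0 : F)) ∈ unitCircle F := by simp [mem_unitCircle]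
  have h01 : ((0 : F), (1 : F)) ∈ unitCircle F := by simp [mem_unitCircle]
  rw [sum_add_distrib, sum_add_distrib, ← mul_sum, ← mul_sum, ← mul_sum, sum_ite_eq',
    sum_ite_eq', if_pos h10, if_pos h01] at h
  have e (z : F × F) : (1 + quadraticChar F z.1) * (1 + quadraticChar F z.2) *
      (1 + quadraticChar F (1 - z.1 - z.2)) =
      1 + quadraticChar F z.1 * 1 + quadraticChar F z.2 * 1
      + quadraticChar F z.1 * quadraticChar F z.2
      + quadraticChar F (1 - z.1 - z.2) + quadraticChar F z.1 * quadraticChar F (1 - z.1 - z.2)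
      + quadraticChar F z.2 * quadraticChar F (1 - z.1 - z.2)
      + quadraticChar F z.1 * quadraticChar F z.2 * quadraticChar F (1 - z.1 - z.2) := by
    ring
  have hy : ∑ z ∈ unitCircle F, quadraticChar F z.2 * (1 : ℤ) = 0 := by
    rw [← sum_unitCircle_swap fun x _ => quadraticChar F x * (1 : ℤ)]
    exact sum_unitCircle_quadraticChar_fst_mul hm fun _ => 1
  have hy' : ∑ z ∈ unitCircle F, quadraticChar F z.2 * quadraticChar F (1 - z.1 - z.2) = 1 := by
    rw [sum_unitCircle_swap fun x y => quadraticChar F y * quadraticChar F (1 - x - y),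
      ← sum_unitCircle_quadraticChar_fst_mul_one_sub hm]
    simp only [sub_right_comm]
  simp only [e, sum_add_distrib] at h
  rw [sum_unitCircle_quadraticChar_fst_mul hm fun _ => 1, hy, hy',
    sum_unitCircle_quadraticChar_fst_mul hm (quadraticChar F),
    sum_unitCircle_quadraticChar_fst_mul_one_sub hm, sum_unitCircle_quadraticChar_one_sub hm,
    sum_unitCircle_quadraticChar_mul_mul_one_sub hm, sum_const, nsmul_eq_mul,
    card_unitCircle hm] at h
  linear_combination -h

end UnitCircle

section Solutions

variable {F : Type*} [Field F] [Fintype F] [DecidableEq F]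

theorem two_mul_sum_quadraticChar_eq_one (hm : quadraticChar F (-1) = -1) :
    2 * ∑ a : F, (if quadraticChar F a = 1 then (1 : ℤ) else 0) = Fintype.card F - 1 := by
  have h (a : F) : 2 * (if quadraticChar F a = 1 then (1 : ℤ) else 0) =
      1 + quadraticChar F a - if a = 0 then 1 else 0 := by
    by_cases ha : a = 0
    · simp [ha]
    · rcases quadraticChar_dichotomy ha with h | h <;> simp [h, ha]
  rw [mul_sum]
  simp only [h, sum_add_distrib, sum_sub_distrib, sum_const, card_univ, nsmul_eq_mul, sum_ite_eq',
    mem_univ, if_true, quadraticChar_sum_zero (ringChar_ne_two_of_quadraticChar_neg_one hm)]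
  ring

theorem two_mul_indicator_quadraticChar_ne_one (a : F) :
    2 * (if quadraticChar F a ≠ 1 then (1 : ℤ) else 0) =
      1 - quadraticChar F a + if a = 0 then 1 else 0 := by
  by_cases ha : a = 0
  · simp [ha]
  · rcases quadraticChar_dichotomy ha with h | h <;> simp [h, ha]

theorem two_mul_sum_quadraticChar_ne_one (hm : quadraticChar F (-1) = -1) :
    2 * ∑ a : F, (if quadraticChar F a ≠ 1 then (1 : ℤ) else 0) = Fintype.card F + 1 := by
  rw [mul_sum]
  simp only [two_mul_indicator_quadraticChar_ne_one]
  simp only [sum_add_distrib, sum_sub_distrib, sum_const, card_univ, nsmul_eq_mul, sum_ite_eq',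
    mem_univ, if_true, quadraticChar_sum_zero (ringChar_ne_two_of_quadraticChar_neg_one hm)]
  ring

theorem four_mul_sum_quadraticChar_ne_one_add (hm : quadraticChar F (-1) = -1) {u : F}
    (hu : u ≠ 0) :
    4 * ∑ b : F, (if quadraticChar F b ≠ 1 then (1 : ℤ) else 0) *
      (if quadraticChar F (b + u) ≠ 1 then (1 : ℤ) else 0) = Fintype.card F + 1 := by
  have h (b : F) : 4 * ((if quadraticChar F b ≠ 1 then (1 : ℤ) else 0) *
      (if quadraticChar F (b + u) ≠ 1 then (1 : ℤ) else 0)) =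
      1 - quadraticChar F b - quadraticChar F (b + u) +
        quadraticChar F b * quadraticChar F (b + u) +
        (if b = 0 then 1 - quadraticChar F u else 0) +
        (if b = -u then 1 + quadraticChar F u else 0) := by
    have h1 := two_mul_indicator_quadraticChar_ne_one b
    have h2 := two_mul_indicator_quadraticChar_ne_one (b + u)
    have : ∀ x y : ℤ, 4 * (x * y) = (2 * x) * (2 * y) := fun x y => by ring
    rw [this, h1, h2]
    simp only [← eq_neg_iff_add_eq_zero (a := b)]
    by_cases hb : b = 0
    · subst hb
      simp [(neg_ne_zero.2 hu).symm]
      ring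
    by_cases hb' : b = -u
    · subst hb'
      simp [quadraticChar_neg hm, hu]
      ring
    simp only [hb, hb', if_false]
    ring
  have hs : ∑ b, quadraticChar F (b + u) = 0 := by
    rw [← quadraticChar_sum_zero (ringChar_ne_two_of_quadraticChar_neg_one hm)]
    exact Fintype.sum_equiv (Equiv.addRight u) _ _ fun t => rfl
  rw [mul_sum]
  simp only [h, sum_add_distrib, sum_sub_distrib, hs,
    sum_quadraticChar_mul_quadraticChar_add_s14 hm hu,
    quadraticChar_sum_zero (ringChar_ne_two_of_quadraticChar_neg_one hm), sum_ite_eq',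
    mem_univ, if_true, sum_const, card_univ, nsmul_eq_mul]
  ring

theorem sum_indicator_sub_add_sub_eq_zero (t : F → F → F → F → ℤ) :
    ∑ a, ∑ b, ∑ c, ∑ d, (if a - b + c - d = 0 then t a b c d else 0) =
      ∑ a, ∑ b, ∑ c, t a b c (a - b + c) := by
  simp [sub_eq_zero]

theorem sum_quadraticChar_ne_one_energy (hm : quadraticChar F (-1) = -1) :
    16 * ∑ a : F, ∑ b : F, ∑ c : F, ∑ d : F, (if a - b + c - d = 0 then
      if quadraticChar F a ≠ 1 ∧ quadraticChar F b ≠ 1 ∧ quadraticChar F c ≠ 1 ∧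
        quadraticChar F d ≠ 1 then (1 : ℤ) else 0 else 0) =
      (Fintype.card F + 1) ^ 2 * (Fintype.card F + 3) := by
  rw [sum_indicator_sub_add_sub_eq_zero fun a b c d =>
    if quadraticChar F a ≠ 1 ∧ quadraticChar F b ≠ 1 ∧ quadraticChar F c ≠ 1 ∧
      quadraticChar F d ≠ 1 then (1 : ℤ) else 0]
  set τ : F → ℤ := fun a => if quadraticChar F a ≠ 1 then (1 : ℤ) else 0 with hτ
  set r : F → ℤ := fun u => ∑ b, τ b * τ (b + u) with hr
  have h1 : ∑ a : F, ∑ b : F, ∑ c : F, (if quadraticChar F a ≠ 1 ∧ quadraticChar F b ≠ 1 ∧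
      quadraticChar F c ≠ 1 ∧ quadraticChar F (a - b + c) ≠ 1 then (1 : ℤ) else 0) =
      ∑ u, r u ^ 2 := by
    calc _ = ∑ b, ∑ a, ∑ c, τ b * τ a * (τ c * τ (a - b + c)) := by
          rw [sum_comm]
          refine sum_congr rfl fun b _ => sum_congr rfl fun a _ => sum_congr rfl fun c _ => ?_
          simp only [hτ]
          split_ifs <;> simp_all
      _ = ∑ b, ∑ u, ∑ c, τ b * τ (b + u) * (τ c * τ (c + u)) := by
          refine sum_congr rfl fun b _ => Fintype.sum_equiv (Equiv.subRight b) _ _ fun a => ?_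
          refine sum_congr rfl fun c _ => ?_
          simp only [Equiv.subRight_apply]
          rw [add_sub_cancel, add_comm c]
      _ = ∑ u, r u ^ 2 := by
          rw [sum_comm]
          refine sum_congr rfl fun u _ => ?_
          rw [sq, hr, sum_mul_sum]
  have h0 : 2 * r 0 = Fintype.card F + 1 := by
    rw [← two_mul_sum_quadraticChar_ne_one hm, hr]
    congr 1
    refine sum_congr rfl fun b _ => ?_
    simp [hτ]
  have hu (u : F) (hu : u ≠ 0) : 4 * r u = Fintype.card F + 1 :=
    four_mul_sum_quadraticChar_ne_one_add hm hu
  have hsq (u : F) : 16 * r u ^ 2 =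
      ((Fintype.card F : ℤ) + 1) ^ 2 + if u = 0 then 3 * ((Fintype.card F : ℤ) + 1) ^ 2 else 0 := by
    split_ifs with h
    · subst h
      rw [← h0]
      ring
    · rw [← hu u h]
      ring
  rw [h1, mul_sum]
  simp only [hsq, sum_add_distrib, sum_const, card_univ, nsmul_eq_mul, sum_ite_eq', mem_univ,
    if_true]
  ring

/-- The indicator of solutions in which exactly the first three entries are nonzero squares. -/
def tripleIndicator (a b c d : F) : ℤ :=
  if a - b + c - d = 0 then
    if quadraticChar F b = 1 ∧ quadraticChar F a = 1 ∧ quadraticChar F c = 1 ∧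
      quadraticChar F d ≠ 1 ∧ a ^ 2 + c ^ 2 = b ^ 2 then 1 else 0
  else 0

theorem sum_tripleIndicator (hm : quadraticChar F (-1) = -1) :
    16 * ∑ a : F, ∑ b : F, ∑ c : F, ∑ d : F, tripleIndicator a b c d =
      (Fintype.card F - 1) * (Fintype.card F + 1 + (quadraticChar F 2 - 1) *
        ∑ x : F, quadraticChar F (x * (x ^ 2 - 2 * x - 1))) := by
  simp only [tripleIndicator]
  rw [sum_indicator_sub_add_sub_eq_zero fun a b c d =>
    if quadraticChar F b = 1 ∧ quadraticChar F a = 1 ∧ quadraticChar F c = 1 ∧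
      quadraticChar F d ≠ 1 ∧ a ^ 2 + c ^ 2 = b ^ 2 then (1 : ℤ) else 0]
  rw [sum_comm, ← sum_unitCircle_indicator hm, ← two_mul_sum_quadraticChar_eq_one hm]
  have h (b : F) : ∑ a : F, ∑ c : F, (if quadraticChar F b = 1 ∧ quadraticChar F a = 1 ∧
      quadraticChar F c = 1 ∧ quadraticChar F (a - b + c) ≠ 1 ∧ a ^ 2 + c ^ 2 = b ^ 2
      then (1 : ℤ) else 0) = (if quadraticChar F b = 1 then (1 : ℤ) else 0) *
      ∑ z ∈ unitCircle F, (if quadraticChar F z.1 = 1 ∧ quadraticChar F z.2 = 1 ∧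
        quadraticChar F (z.1 + z.2 - 1) ≠ 1 then (1 : ℤ) else 0) := by
    split_ifs with hb
    · have hb0 : b ≠ 0 := by
        rintro rfl
        simp at hb
      rw [unitCircle, sum_filter, Fintype.sum_prod_type, one_mul]
      refine (Fintype.sum_equiv (Equiv.mulLeft₀ b hb0) _ _ fun x =>
        Fintype.sum_equiv (Equiv.mulLeft₀ b hb0) _ _ fun y => ?_).symm
      change _ = if quadraticChar F b = 1 ∧ quadraticChar F (b * x) = 1 ∧
        quadraticChar F (b * y) = 1 ∧ quadraticChar F (b * x - b + b * y) ≠ 1 ∧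
        (b * x) ^ 2 + (b * y) ^ 2 = b ^ 2 then (1 : ℤ) else 0
      have e : (b * x) ^ 2 + (b * y) ^ 2 = b ^ 2 ↔ x ^ 2 + y ^ 2 = 1 := by
        rw [← mul_right_inj' (pow_ne_zero 2 hb0) (b := x ^ 2 + y ^ 2)]
        ring_nf
      simp only [show b * x - b + b * y = b * (x + y - 1) by ring, e, map_mul, hb, one_mul,
        true_and]
      split_ifs <;> simp_all
    · simp only [hb, false_and, if_false, sum_const_zero, zero_mul]
  simp only [h]
  rw [← sum_mul]
  ring

theorem signed_indicator_eq_of_linear {R : Type*} [CommRing R] [DecidableEq R] (a b c d A B C D : R) (P Q S T : Prop)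
    [Decidable P] [Decidable Q] [Decidable S] [Decidable T]
    (hfac : a - b + c - d = 0 → A - B + C - D = 0 → a = b ∧ c = d ∨ a = d ∧ c = b)
    (ha : P → A ≠ 0) (hb : Q → B ≠ 0) (hc : S → C ≠ 0) (hd : T → D ≠ 0)
    (hac : P → A + C ≠ 0) (hbd : Q → B + D ≠ 0)
    (hab : P → Q → A = B → a = b) (had : P → T → A = D → a = d)
    (hcb : S → Q → C = B → c = b) (hcd : S → T → C = D → c = d)
    (eab : a = b → A = B ∧ (P ↔ Q)) (ead : a = d → A = D ∧ (P ↔ T))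
    (ecb : c = b → C = B ∧ (S ↔ Q)) (ecd : c = d → C = D ∧ (S ↔ T)) :
    (if a - b + c - d = 0 ∧ (if P then A else 0) - (if Q then B else 0) + (if S then C else 0) -
        (if T then D else 0) = 0 then (1 : ℤ) else 0) =
      (if a - b + c - d = 0 then
        if ¬P ∧ ¬Q ∧ ¬S ∧ ¬T then (1 : ℤ) else 0 else 0) +
      (if a = b ∧ c = d ∧ ¬(¬P ∧ ¬S) then 1 else 0) +
      (if a = d ∧ c = b ∧ ¬(¬P ∧ ¬S) then 1 else 0) -
      (if a = b ∧ a = c ∧ a = d ∧ P then 1 else 0) +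
      (if a - b + c - d = 0 then if Q ∧ P ∧ S ∧ ¬T ∧ A + C = B then 1 else 0 else 0) +
      (if a - d + c - b = 0 then if T ∧ P ∧ S ∧ ¬Q ∧ A + C = D then 1 else 0 else 0) +
      (if b - c + d - a = 0 then if S ∧ Q ∧ T ∧ ¬P ∧ B + D = C then 1 else 0 else 0) +
      (if b - a + d - c = 0 then if P ∧ Q ∧ T ∧ ¬S ∧ B + D = A then 1 else 0 else 0) := by
  by_cases hP : P <;> by_cases hQ : Q <;> by_cases hS : S <;> by_cases hT : T <;>
    simp only [hP, hQ, hS, hT, if_true, if_false, true_and, and_true, false_and, and_false,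
      iff_true, iff_false, forall_const, IsEmpty.forall_iff, ite_self,
      not_true, not_false_eq_true] at * <;>
    grind

theorem solution_indicator_eq (hm : quadraticChar F (-1) = -1) (a b c d : F) :
    (if a - b + c - d = 0 ∧
        ((1 + quadraticChar F a : ℤ) : F) * a ^ 2 - ((1 + quadraticChar F b : ℤ) : F) * b ^ 2 +
          ((1 + quadraticChar F c : ℤ) : F) * c ^ 2 -
          ((1 + quadraticChar F d : ℤ) : F) * d ^ 2 = 0 then (1 : ℤ) else 0) =
      (if a - b + c - d = 0 then
        if quadraticChar F a ≠ 1 ∧ quadraticChar F b ≠ 1 ∧ quadraticChar F c ≠ 1 ∧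
          quadraticChar F d ≠ 1 then (1 : ℤ) else 0 else 0) +
      (if a = b ∧ c = d ∧ ¬(quadraticChar F a ≠ 1 ∧ quadraticChar F c ≠ 1) then 1 else 0) +
      (if a = d ∧ c = b ∧ ¬(quadraticChar F a ≠ 1 ∧ quadraticChar F c ≠ 1) then 1 else 0) -
      (if a = b ∧ a = c ∧ a = d ∧ quadraticChar F a = 1 then 1 else 0) +
      tripleIndicator a b c d + tripleIndicator a d c b + tripleIndicator b c d a +
      tripleIndicator b a d c := by
  have h2 := two_ne_zero_of_quadraticChar_neg_one hm
  have hcast (x : F) : ((1 + quadraticChar F x : ℤ) : F) * x ^ 2 =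
      2 * if quadraticChar F x = 1 then x ^ 2 else 0 := by
    by_cases hx : x = 0
    · simp [hx]
    · rcases quadraticChar_dichotomy hx with h | h
      · simp [h, one_add_one_eq_two]
      · simp [h]
  have h0 (x : F) (hx : quadraticChar F x = 1) : x ≠ 0 := by
    rintro rfl
    simp at hx
  have hsum (x y : F) (hx : quadraticChar F x = 1) : x ^ 2 + y ^ 2 ≠ 0 := by
    rw [add_comm]
    exact add_sq_ne_zero_of_ne_zero hm (h0 x hx)
  have hsq (x y : F) (hx : quadraticChar F x = 1) (hy : quadraticChar F y = 1)
      (h : x ^ 2 = y ^ 2) : x = y := by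
    refine (sq_eq_sq_iff_eq_or_eq_neg.1 h).resolve_right fun h => ?_
    rw [h, quadraticChar_neg hm, hy] at hx
    norm_num at hx
  have heq (x y : F) (h : x = y) :
      x ^ 2 = y ^ 2 ∧ (quadraticChar F x = 1 ↔ quadraticChar F y = 1) := by
    simp [h]
  have hfac (h : a - b + c - d = 0) (h' : a ^ 2 - b ^ 2 + c ^ 2 - d ^ 2 = 0) :
      a = b ∧ c = d ∨ a = d ∧ c = b := by
    have h3 : 2 * ((a - b) * (a - d)) = 0 := by
      linear_combination h' + (a - b - c - d) * h
    have h4 : a = b ∨ a = d := by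
      simpa [h2, sub_eq_zero] using h3
    rcases h4 with h4 | h4
    · exact .inl ⟨h4, by linear_combination h - h4⟩
    · exact .inr ⟨h4, by linear_combination h - h4⟩
  simp only [hcast, tripleIndicator, ← mul_sub, ← mul_add, mul_eq_zero, h2, false_or]
  exact signed_indicator_eq_of_linear a b c d (a ^ 2) (b ^ 2) (c ^ 2) (d ^ 2) _ _ _ _ hfac
    (fun h => pow_ne_zero 2 (h0 a h)) (fun h => pow_ne_zero 2 (h0 b h))
    (fun h => pow_ne_zero 2 (h0 c h)) (fun h => pow_ne_zero 2 (h0 d h))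
    (hsum a c) (hsum b d) (hsq a b) (hsq a d) (hsq c b) (hsq c d)
    (heq a b) (heq a d) (heq c b) (heq c d)

theorem four_mul_sum_diagonal (hm : quadraticChar F (-1) = -1) :
    4 * ∑ a : F, ∑ c : F,
        (if ¬(quadraticChar F a ≠ 1 ∧ quadraticChar F c ≠ 1) then (1 : ℤ) else 0) =
      4 * (Fintype.card F : ℤ) ^ 2 - (Fintype.card F + 1) ^ 2 := by
  have h (a c : F) :
      (if ¬(quadraticChar F a ≠ 1 ∧ quadraticChar F c ≠ 1) then (1 : ℤ) else 0) =
        1 - (if quadraticChar F a ≠ 1 then (1 : ℤ) else 0) *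
          (if quadraticChar F c ≠ 1 then (1 : ℤ) else 0) := by
    by_cases ha : quadraticChar F a = 1 <;> by_cases hc : quadraticChar F c = 1 <;>
      simp [ha, hc, -quadraticChar_apply]
  simp only [h, sum_sub_distrib, sum_const, card_univ, nsmul_eq_mul]
  rw [← sum_mul_sum, ← two_mul_sum_quadraticChar_ne_one hm]
  ring

theorem sum_solution_indicator (hm : quadraticChar F (-1) = -1) :
    16 * ∑ a : F, ∑ b : F, ∑ c : F, ∑ d : F, (if a - b + c - d = 0 ∧
        ((1 + quadraticChar F a : ℤ) : F) * a ^ 2 - ((1 + quadraticChar F b : ℤ) : F) * b ^ 2 +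
          ((1 + quadraticChar F c : ℤ) : F) * c ^ 2 -
          ((1 + quadraticChar F d : ℤ) : F) * d ^ 2 = 0 then (1 : ℤ) else 0) =
      ((Fintype.card F : ℤ) - 1) * ((Fintype.card F : ℤ) ^ 2 + 34 * Fintype.card F + 17 +
        4 * (quadraticChar F 2 - 1) *
          ∑ x : F, quadraticChar F (x * (x ^ 2 - 2 * x - 1))) + 16 := by
  simp only [solution_indicator_eq hm, sum_add_distrib, sum_sub_distrib]
  have hD1 : ∑ a : F, ∑ b : F, ∑ c : F, ∑ d : F, (if a = b ∧ c = d ∧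
      ¬(quadraticChar F a ≠ 1 ∧ quadraticChar F c ≠ 1) then (1 : ℤ) else 0) =
      ∑ a : F, ∑ c : F,
        (if ¬(quadraticChar F a ≠ 1 ∧ quadraticChar F c ≠ 1) then (1 : ℤ) else 0) := by
    refine sum_congr rfl fun a _ => ?_
    simp only [ite_and, sum_ite_irrel, sum_const_zero, sum_ite_eq, mem_univ, if_true]
  have hD2 : ∑ a : F, ∑ b : F, ∑ c : F, ∑ d : F, (if a = d ∧ c = b ∧
      ¬(quadraticChar F a ≠ 1 ∧ quadraticChar F c ≠ 1) then (1 : ℤ) else 0) =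
      ∑ a : F, ∑ c : F,
        (if ¬(quadraticChar F a ≠ 1 ∧ quadraticChar F c ≠ 1) then (1 : ℤ) else 0) := by
    refine sum_congr rfl fun a _ => ?_
    rw [sum_comm]
    simp only [ite_and, sum_ite_eq, mem_univ, if_true]
  have hD3 : ∑ a : F, ∑ b : F, ∑ c : F, ∑ d : F, (if a = b ∧ a = c ∧ a = d ∧
      quadraticChar F a = 1 then (1 : ℤ) else 0) =
      ∑ a : F, (if quadraticChar F a = 1 then (1 : ℤ) else 0) := by
    refine sum_congr rfl fun a _ => ?_
    simp [ite_and, -quadraticChar_apply]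
  have hT2 : ∑ a : F, ∑ b : F, ∑ c : F, ∑ d : F, tripleIndicator a d c b =
      ∑ a : F, ∑ b : F, ∑ c : F, ∑ d : F, tripleIndicator a b c d := by
    refine sum_congr rfl fun a _ => ?_
    rw [sum_comm_cycle]
    refine sum_congr rfl fun d _ => ?_
    rw [sum_comm]
  have hT3 : ∑ a : F, ∑ b : F, ∑ c : F, ∑ d : F, tripleIndicator b c d a =
      ∑ a : F, ∑ b : F, ∑ c : F, ∑ d : F, tripleIndicator a b c d := by
    rw [sum_comm]
    refine sum_congr rfl fun b _ => ?_
    rw [sum_comm]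
    refine sum_congr rfl fun c _ => ?_
    rw [sum_comm]
  have hT4 : ∑ a : F, ∑ b : F, ∑ c : F, ∑ d : F, tripleIndicator b a d c =
      ∑ a : F, ∑ b : F, ∑ c : F, ∑ d : F, tripleIndicator a b c d := by
    rw [sum_comm]
    refine sum_congr rfl fun b _ => sum_congr rfl fun a _ => ?_
    rw [sum_comm]
  rw [hD1, hD2, hD3, hT2, hT3, hT4]
  linear_combination sum_quadraticChar_ne_one_energy hm + 8 * four_mul_sum_diagonal hm -
    8 * two_mul_sum_quadraticChar_eq_one hm + 4 * sum_tripleIndicator hm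

end Solutions

theorem stmt_14 (p n : ℕ) (hp : p.Prime) (hodd : p ≠ 2) (hn : 0 < n)
    (h3 : p ^ n % 4 = 3)
    (F : Type*) [Field F] [Fintype F] [DecidableEq F]
    (hcard : Fintype.card F = p ^ n) :
    (Set.ncard {x : F × F × F × F |
        x.1 - x.2.1 + x.2.2.1 - x.2.2.2 = 0 ∧
        ((1 + quadraticChar F x.1 : ℤ) : F) * x.1 ^ 2 -
          ((1 + quadraticChar F x.2.1 : ℤ) : F) * x.2.1 ^ 2 +
          ((1 + quadraticChar F x.2.2.1 : ℤ) : F) * x.2.2.1 ^ 2 -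
          ((1 + quadraticChar F x.2.2.2 : ℤ) : F) * x.2.2.2 ^ 2 = 0} : ℚ) =
      1/16 * ((p : ℚ) ^ n - 1) *
        ((p : ℚ) ^ (2 * n) + 34 * (p : ℚ) ^ n + 17 +
          4 * (((quadraticChar F 2 : ℤ) : ℚ) - 1) *
            ((∑ x : F, quadraticChar F (x * (x ^ 2 - 2 * x - 1)) : ℤ) : ℚ)) + 1 := by
  have hm : quadraticChar F (-1) = -1 := by
    rw [quadraticChar_neg_one_iff_not_isSquare, FiniteField.isSquare_neg_one_iff, hcard]
    simpa using h3
  have key := sum_solution_indicator hm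
  rw [Set.ncard_eq_toFinset_card', Set.toFinset_ofPred, card_filter, Fintype.sum_prod_type]
  simp only [Fintype.sum_prod_type]
  rw [hcard] at key
  have keyQ := congrArg (Int.cast : ℤ → ℚ) key
  push_cast at keyQ ⊢
  rw [pow_mul', ← mul_right_inj' (show (16 : ℚ) ≠ 0 by norm_num), keyQ]
  ring
end
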